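/- arXiv:math/0409562 — 2 statements merged into one kernel-verified Lean document; each statement's English description precedes it below -/
import Mathlib

section
/- For every d-dimensional pointed rational cone K ⊂ ℝ^d there exists a unimodular transformation φ ∈ SL_d(ℤ) such that φ(K) ⊆ ℝ_{≥0}^d and φ(K) intersects the boundary of the nonnegative orthant only at the origin; that is, every nonzero point of φ(K) has all d coordinates strictly positive. -/
/-- On a closed cone, any continuous functional becomes strictly positive away from the origin
after adding a large natural multiple of a functional that is strictly positive there. -/
theorem exists_nat_forall_pos_add_mul {E : Type*} [NormedAddCommGroup E] [NormedSpace ℝ E]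
    [ProperSpace E] {K : Set E} (hclosed : IsClosed K)
    (hsmul : ∀ c : ℝ, 0 < c → ∀ r ∈ K, c • r ∈ K) (f g : E →L[ℝ] ℝ)
    (hf : ∀ r ∈ K, r ≠ 0 → 0 < f r) :
    ∃ N : ℕ, ∀ r ∈ K, r ≠ 0 → 0 < g r + N * f r := by
  have hcompact : IsCompact (K ∩ Metric.sphere (0 : E) 1) :=
    (isCompact_sphere _ _).inter_left hclosed
  have hne : ∀ r ∈ K ∩ Metric.sphere (0 : E) 1, r ≠ 0 := by
    rintro r ⟨-, hr⟩ rfl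
    simp at hr
  obtain ⟨c, hc⟩ := hcompact.bddBelow_image (f := fun r => g r / f r)
    (g.continuous.continuousOn.div f.continuous.continuousOn
      fun r hr => (hf r hr.1 (hne r hr)).ne')
  obtain ⟨N, hN⟩ := exists_nat_gt (-c)
  refine ⟨N, fun r hr hr0 => ?_⟩
  have hnorm : 0 < ‖r‖ := norm_pos_iff.2 hr0
  have hfr := hf r hr hr0
  have hmem : ‖r‖⁻¹ • r ∈ K ∩ Metric.sphere (0 : E) 1 := by
    refine ⟨hsmul _ (inv_pos.2 hnorm) r hr, ?_⟩
    simp [norm_smul, hnorm.ne']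
  have h : c ≤ g r / f r := by
    have := hc (Set.mem_image_of_mem _ hmem)
    simpa [mul_div_mul_left _ _ (inv_pos.2 hnorm).ne'] using this
  rw [le_div_iff₀ hfr] at h
  nlinarith

/-- A nonzero vector of a finite free module over a PID is a multiple of a basis vector. -/
theorem exists_basis_smul_eq {R M ι : Type*} [CommRing R] [IsDomain R] [IsPrincipalIdealRing R]
    [AddCommGroup M] [Module R M] [Finite ι] (b₀ : Module.Basis ι R M) {w : M} (hw : w ≠ 0) :
    ∃ (b : Module.Basis ι R M) (i : ι) (k : R), w = k • b i := by
  have : Module.Free R M := .of_basis b₀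
  obtain ⟨n, bM, bN, f, a, snf⟩ := Submodule.smithNormalForm b₀ (Submodule.span R {w})
  have hn : n = 1 := by
    have h := (LinearEquiv.toSpanNonzeroSingleton R M w hw).finrank_eq
    rw [Module.finrank_self, Module.finrank_eq_card_basis bN, Fintype.card_fin] at h
    exact h.symm
  subst hn
  refine ⟨bM, f 0, bN.repr ⟨w, Submodule.mem_span_singleton_self w⟩ 0 * a 0, ?_⟩
  have h := congrArg Subtype.val (bN.sum_repr ⟨w, Submodule.mem_span_singleton_self w⟩)
  rw [Fin.sum_univ_one, Submodule.coe_smul, snf, smul_smul] at h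
  exact h.symm

/-- A nonzero integer vector is a positive multiple of a member of some `ℤ`-basis. -/
theorem exists_int_basis_pos_smul_eq {M ι : Type*} [AddCommGroup M] [Finite ι]
    (b₀ : Module.Basis ι ℤ M) {w : M} (hw : w ≠ 0) :
    ∃ (b : Module.Basis ι ℤ M) (i : ι) (k : ℤ), 0 < k ∧ w = k • b i := by
  obtain ⟨b, i, k, hk⟩ := exists_basis_smul_eq b₀ hw
  rcases lt_trichotomy k 0 with h | rfl | h
  · exact ⟨b.map (LinearEquiv.neg ℤ), i, -k, neg_pos.2 h, by simp [hk]⟩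
  · exact absurd (by simpa using hk) hw
  · exact ⟨b, i, k, h, hk⟩

theorem det_of_int_basis {d : ℕ} (b : Module.Basis (Fin d) ℤ (Fin d → ℤ)) :
    (Matrix.of b).det = 1 ∨ (Matrix.of b).det = -1 := by
  have h := (Pi.basisFun ℤ (Fin d)).isUnit_det b
  have htranspose : (Pi.basisFun ℤ (Fin d)).toMatrix b = (Matrix.of b).transpose := by
    ext i j
    simp [Module.Basis.toMatrix_apply]
  rw [Module.Basis.det_apply, htranspose, Matrix.det_transpose] at h
  exact Int.isUnit_iff.1 h

/-- Pairing with an integer vector, as a continuous functional. -/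
noncomputable def intDotProduct {d : ℕ} (v : Fin d → ℤ) : (Fin d → ℝ) →L[ℝ] ℝ :=
  ∑ j, (v j : ℝ) • ContinuousLinearMap.proj j

theorem intDotProduct_apply {d : ℕ} (v : Fin d → ℤ) (r : Fin d → ℝ) :
    intDotProduct v r = ∑ j, (v j : ℝ) * r j := by
  simp [intDotProduct]

theorem map_intCast_mulVec_apply {m d : ℕ} (B : Matrix (Fin m) (Fin d) ℤ) (r : Fin d → ℝ)
    (i : Fin m) : (B.map (fun a => (a : ℝ))).mulVec r i = intDotProduct (B i) r := by
  simp [intDotProduct_apply, Matrix.mulVec, dotProduct]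

/-- Every `d`-dimensional pointed rational cone `K ⊂ ℝ^d` can be mapped by a unimodular
transformation `φ ∈ SL_d(ℤ)` (an integer matrix of determinant `±1`) into the nonnegative
orthant in such a way that the image intersects the boundary of the orthant only at the
origin, i.e. every nonzero point of `φ(K)` has all coordinates strictly positive. -/
theorem pointed_cone_unimodular_into_positive_orthant
    (d m : ℕ) (A : Matrix (Fin m) (Fin d) ℤ) (K : Set (Fin d → ℝ))
    (hK : K = {r : Fin d → ℝ | ∀ i, (A.map (fun a => (a : ℝ))).mulVec r i ≤ 0})
    (hpointed : ∀ x ∈ K, -x ∈ K → x = 0)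
    (hdim : Submodule.span ℝ K = ⊤) :
    ∃ φ : Matrix (Fin d) (Fin d) ℤ,
      (φ.det = 1 ∨ φ.det = -1) ∧
      (∀ r ∈ K, ∀ j, 0 ≤ (φ.map (fun a => (a : ℝ))).mulVec r j) ∧
      (∀ r ∈ K, r ≠ 0 → ∀ j, 0 < (φ.map (fun a => (a : ℝ))).mulVec r j) := by
  simp only [map_intCast_mulVec_apply] at hK ⊢
  suffices h : ∃ φ : Matrix (Fin d) (Fin d) ℤ, (φ.det = 1 ∨ φ.det = -1) ∧
      ∀ r ∈ K, r ≠ 0 → ∀ j, 0 < intDotProduct (φ j) r by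
    obtain ⟨φ, hdet, hpos⟩ := h
    refine ⟨φ, hdet, fun r hr j => ?_, hpos⟩
    rcases eq_or_ne r 0 with rfl | hr0
    · simp
    · exact (hpos r hr hr0 j).le
  have hmem : ∀ r, r ∈ K ↔ ∀ i, intDotProduct (A i) r ≤ 0 := by simp [hK]
  have hclosed : IsClosed K := by
    rw [hK, Set.ofPred_forall]
    exact isClosed_iInter fun i => isClosed_le (intDotProduct (A i)).continuous continuous_const
  have hsmul : ∀ c : ℝ, 0 < c → ∀ r ∈ K, c • r ∈ K := by
    intro c hc r hr
    rw [hmem] at hr ⊢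
    intro i
    simpa using mul_nonpos_of_nonneg_of_nonpos hc.le (hr i)
  let w : Fin d → ℤ := fun j => -∑ i, A i j
  have hwapply : ∀ r, intDotProduct w r = ∑ i, -intDotProduct (A i) r := by
    intro r
    simp only [w, intDotProduct_apply, Int.cast_neg, Int.cast_sum, neg_mul, Finset.sum_mul,
      Finset.sum_neg_distrib]
    rw [Finset.sum_comm]
  have hwpos : ∀ r ∈ K, r ≠ 0 → 0 < intDotProduct w r := by
    intro r hr hr0
    rw [hwapply]
    have hr' := (hmem r).1 hr
    refine (Finset.sum_nonneg fun i _ => neg_nonneg.2 (hr' i)).lt_of_ne' fun h => hr0 ?_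
    rw [Finset.sum_eq_zero_iff_of_nonneg fun i _ => neg_nonneg.2 (hr' i)] at h
    refine hpointed r hr ((hmem _).2 fun i => ?_)
    simpa using (h i (Finset.mem_univ i)).le
  rcases eq_or_ne w 0 with hw | hw
  · refine ⟨1, by simp, fun r hr hr0 => ?_⟩
    have := hwpos r hr hr0
    rw [hw] at this
    simp [intDotProduct_apply] at this
  obtain ⟨b, i₀, k, hk, hwb⟩ := exists_int_basis_pos_smul_eq (Pi.basisFun ℤ (Fin d)) hw
  have hb : ∀ r ∈ K, r ≠ 0 → 0 < intDotProduct (b i₀) r := by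
    intro r hr hr0
    have h := hwpos r hr hr0
    rw [hwb] at h
    have hsm : intDotProduct (k • b i₀) r = k * intDotProduct (b i₀) r := by
      simp [intDotProduct_apply, Finset.mul_sum, mul_assoc]
    rw [hsm] at h
    exact pos_of_mul_pos_right h (by exact_mod_cast hk.le)
  choose N hN using fun i =>
    exists_nat_forall_pos_add_mul hclosed hsmul _ (intDotProduct (b i)) hb
  let c : Fin d → ℤ := fun i => if i = i₀ then 0 else N i
  refine ⟨Matrix.of fun i j => b i j + c i * b i₀ j, ?_, fun r hr hr0 i => ?_⟩
  · have hdet := Matrix.det_eq_of_forall_row_eq_smul_add_const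
      (A := Matrix.of fun i j => b i j + c i * b i₀ j) (B := Matrix.of b) c i₀ (by simp [c])
      fun i j => rfl
    rw [hdet]
    exact det_of_int_basis b
  · have hrow : intDotProduct (fun j => b i j + c i * b i₀ j) r =
        intDotProduct (b i) r + c i * intDotProduct (b i₀) r := by
      simp [intDotProduct_apply, Finset.mul_sum, add_mul, mul_assoc, Finset.sum_add_distrib]
    change 0 < intDotProduct (fun j => b i j + c i * b i₀ j) r
    rw [hrow]
    by_cases hi : i = i₀
    · simpa [c, hi] using hb r hr hr0
    · simpa [c, hi] using hN i r hr hr0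
end

section
/- Ehrhart–Macdonald reciprocity: let P ⊂ ℝ^d be a rational convex polytope, i.e., the convex hull of finitely many points of ℚ^d, and let L_P(t) = #(tP ∩ ℤ^d) and L_{P°}(t) = #(tP° ∩ ℤ^d) for positive integers t, where P° is the relative interior of P. Then L_P and L_{P°} are quasi-polynomials in t: there exist a positive integer N and polynomials p_0, …, p_{N−1} ∈ ℚ[t] such that the function f : ℤ → ℚ defined by f(t) = p_{t mod N}(t) satisfies f(t) = L_P(t) for all integers t ≥ 1; moreover this quasi-polynomial satisfies the reciprocity law (−1)^{dim P} f(−t) = L_{P°}(t) for all integers t ≥ 1. -/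
open Pointwise

/-! ### Counting lattice points in half-open simplicial cones -/

open Polynomial in
/-- The polynomial whose value at `n : ℕ` is `(n + r).choose r`. -/
noncomputable def choosePoly (r : ℕ) : ℚ[X] :=
  C ((r.factorial : ℚ)⁻¹) * ∏ j ∈ Finset.range r, (X + C ((j : ℚ) + 1))

lemma eval_choosePoly (r : ℕ) (x : ℚ) :
    (choosePoly r).eval x = (r.factorial : ℚ)⁻¹ * ∏ j ∈ Finset.range r, (x + ((j : ℚ) + 1)) := by
  simp [choosePoly, Polynomial.eval_prod]

lemma eval_choosePoly_natCast (r n : ℕ) :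
    (choosePoly r).eval (n : ℚ) = ((n + r).choose r : ℚ) := by
  have h := congrArg (Nat.cast (R := ℚ)) (Nat.ascFactorial_eq_factorial_mul_choose n r)
  rw [Nat.ascFactorial_eq_prod_range] at h
  push_cast at h
  rw [eval_choosePoly, inv_mul_eq_iff_eq_mul₀ (by positivity), ← h]
  exact Finset.prod_congr rfl fun j _ => by ring

lemma eval_choosePoly_neg (r : ℕ) (x : ℚ) :
    (choosePoly r).eval (-x - (r + 1)) = (-1) ^ r * (choosePoly r).eval x := by
  rw [eval_choosePoly, eval_choosePoly, mul_left_comm, ← Finset.prod_range_reflect]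
  congr 1
  conv_rhs => rw [← Finset.card_range r, ← Finset.prod_const, Finset.card_range,
    ← Finset.prod_mul_distrib]
  refine Finset.prod_congr rfl fun j hj => ?_
  have hj' : j + 1 ≤ r := Finset.mem_range.1 hj
  rw [Nat.sub_sub, Nat.cast_sub (by omega)]
  push_cast
  ring

lemma eval_choosePoly_eq_zero (r m : ℕ) (h1 : 1 ≤ m) (h2 : m ≤ r) :
    (choosePoly r).eval (-(m : ℚ)) = 0 := by
  rw [eval_choosePoly]
  refine mul_eq_zero_of_right _ (Finset.prod_eq_zero (i := m - 1) ?_ ?_)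
  · exact Finset.mem_range.2 (by omega)
  · rw [Nat.cast_sub h1]; ring

lemma natCard_sum_eq {κ : Type*} [Fintype κ] [Nonempty κ] (n : ℕ) :
    Nat.card {m : κ → ℕ // ∑ i, m i = n}
      = (n + (Fintype.card κ - 1)).choose (Fintype.card κ - 1) := by
  classical
  have hk : 1 ≤ Fintype.card κ := Fintype.card_pos
  rw [← Nat.card_congr (Sym.equivNatSumOfFintype κ n), Sym.natCard_sym_eq_choose,
    Nat.card_eq_fintype_card, ← Nat.choose_symm_add]
  congr 1
  omega

/-- Quasi-polynomial counting `m : κ → ℕ` with `a + N * ∑ m = t`. -/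
lemma natCard_add_mul_sum_eq {κ : Type*} [Fintype κ] [Nonempty κ] {N : ℕ} (hN : 0 < N) {a t : ℤ}
    (ht : 1 ≤ t) (ha : a ≤ Fintype.card κ * N) :
    (Nat.card {m : κ → ℕ // a + N * ∑ i, (m i : ℤ) = t} : ℚ)
      = if (a : ZMod N) = t then (choosePoly (Fintype.card κ - 1)).eval (((t : ℚ) - a) / N)
        else 0 := by
  have hk : 1 ≤ Fintype.card κ := Fintype.card_pos
  have hNq : (N : ℚ) ≠ 0 := by positivity
  split_ifs with h
  · rw [ZMod.intCast_eq_intCast_iff_dvd_sub] at h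
    obtain ⟨n, hn⟩ := h
    have hq : ((t : ℚ) - a) / N = n := by
      rw [div_eq_iff hNq, mul_comm]; exact_mod_cast hn
    rw [hq]
    have hN' : (0 : ℤ) < N := by exact_mod_cast hN
    have heq : ∀ m : κ → ℕ, (a + N * ∑ i, (m i : ℤ) = t) ↔ ((∑ i, m i : ℕ) : ℤ) = n := by
      intro m
      push_cast
      constructor
      · intro hm
        exact mul_left_cancel₀ hN'.ne' (by linarith)
      · rintro hm
        rw [hm]; linarith
    rcases le_or_gt 0 n with h0 | h0
    · lift n to ℕ using h0
      simp_rw [heq, Nat.cast_inj]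
      rw [natCard_sum_eq]
      exact (eval_choosePoly_natCast _ _).symm
    · have : IsEmpty {m : κ → ℕ // a + N * ∑ i, (m i : ℤ) = t} := by
        refine ⟨fun m => ?_⟩
        have := (heq m.1).1 m.2
        omega
      rw [Nat.card_of_isEmpty]
      obtain ⟨m, rfl⟩ : ∃ m : ℕ, n = -(m : ℤ) := ⟨n.natAbs, by omega⟩
      have : (m : ℤ) < Fintype.card κ := by
        by_contra! hcon
        nlinarith
      have := eval_choosePoly_eq_zero (Fintype.card κ - 1) m (by omega) (by omega)
      push_cast
      rw [this]
  · have : IsEmpty {m : κ → ℕ // a + N * ∑ i, (m i : ℤ) = t} := by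
      refine ⟨fun m => h ?_⟩
      rw [← m.2]
      push_cast
      simp
    simp

/-- `r` lies in the ray `[0, ∞)` if `closed` holds, and in `(0, ∞)` otherwise. -/
def InRay (closed : Prop) (r : ℝ) : Prop := 0 < r ∨ closed ∧ r = 0

/-- `r` lies in the window `[0, 1)` if `closed` holds, and in `(0, 1]` otherwise. -/
def InWindow (closed : Prop) (r : ℝ) : Prop :=
  (0 < r ∧ r < 1) ∨ (closed ∧ r = 0) ∨ (¬ closed ∧ r = 1)

lemma InWindow.mem_Icc {σ : Prop} {r : ℝ} (h : InWindow σ r) : r ∈ Set.Icc (0 : ℝ) 1 := by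
  rcases h with h | h | h <;> constructor <;> linarith

lemma InWindow.inRay_add {σ : Prop} {r : ℝ} (h : InWindow σ r) (m : ℕ) : InRay σ (r + m) := by
  have hm : (0 : ℝ) ≤ m := m.cast_nonneg
  rcases h with h | ⟨h, rfl⟩ | ⟨h, rfl⟩
  · exact Or.inl (by linarith)
  · rcases hm.eq_or_lt with h0 | h0
    · exact Or.inr ⟨h, by linarith⟩
    · exact Or.inl (by linarith)
  · exact Or.inl (by linarith)

lemma InWindow.one_sub {σ : Prop} {r : ℝ} (h : InWindow σ r) : InWindow (¬ σ) (1 - r) := by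
  rcases h with h | ⟨h, rfl⟩ | ⟨h, rfl⟩
  · exact Or.inl ⟨by linarith, by linarith⟩
  · exact Or.inr (Or.inr ⟨not_not.2 h, by simp⟩)
  · exact Or.inr (Or.inl ⟨h, by simp⟩)

lemma InRay.exists_inWindow_sub {σ : Prop} {r : ℝ} (h : InRay σ r) :
    ∃ m : ℕ, InWindow σ (r - m) := by
  by_cases hσ : σ
  · have hr : 0 ≤ r := by rcases h with h | h <;> linarith
    refine ⟨⌊r⌋₊, ?_⟩
    have h1 := Nat.floor_le hr
    have h2 := Nat.lt_floor_add_one r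
    rcases h1.eq_or_lt with h3 | h3
    · exact Or.inr (Or.inl ⟨hσ, by linarith⟩)
    · exact Or.inl ⟨by linarith, by linarith⟩
  · have hr : 0 < r := by
      rcases h with h | h
      · exact h
      · exact absurd h.1 hσ
    have h0 : 0 < ⌈r⌉₊ := Nat.ceil_pos.2 hr
    refine ⟨⌈r⌉₊ - 1, ?_⟩
    have h1 := Nat.le_ceil r
    have h2 := Nat.ceil_lt_add_one hr.le
    rw [Nat.cast_sub h0, Nat.cast_one]
    rcases h1.eq_or_lt with h3 | h3
    · exact Or.inr (Or.inr ⟨hσ, by linarith⟩)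
    · exact Or.inl ⟨by linarith, by linarith⟩

lemma InWindow.eq_of_add_natCast_eq {σ : Prop} {r s : ℝ} (hr : InWindow σ r) (hs : InWindow σ s)
    {m n : ℕ} (h : r + m = s + n) : m = n := by
  have key : |(m : ℝ) - n| < 1 := by
    have : (m : ℝ) - n = s - r := by linarith
    rw [this, abs_lt]
    rcases hr with hr | hr | hr <;> rcases hs with hs | hs | hs <;>
      first | exact absurd hr.1 hs.1 | exact absurd hs.1 hr.1 | constructor <;> linarith
  have : |(m : ℤ) - n| < 1 := by exact_mod_cast key
  have := Int.abs_lt_one_iff.1 this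
  omega

section HalfOpenCone

open Module

variable {κ E : Type*} [Fintype κ] [AddCommGroup E] [Module ℝ E]

/-- The lattice points of the fundamental parallelepiped with facets prescribed by `σ`. -/
def latticeBox (b : Basis κ ℝ E) (Λ : AddSubgroup E) (σ : κ → Prop) : Set E :=
  {x | x ∈ Λ ∧ ∀ i, InWindow (σ i) (b.repr x i)}

/-- The lattice points at height `t` of the half-open simplicial cone with facets prescribed
by `σ`. -/
def latticeConeSlice (b : Basis κ ℝ E) (Λ : AddSubgroup E) (h : E →ₗ[ℝ] ℝ) (σ : κ → Prop)
    (t : ℤ) : Set E :=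
  {x | x ∈ Λ ∧ (∀ i, InRay (σ i) (b.repr x i)) ∧ h x = t}

variable {b : Basis κ ℝ E} {Λ : AddSubgroup E} {h : E →ₗ[ℝ] ℝ} {N : ℕ}

lemma apply_le_of_mem_latticeBox (hbN : ∀ i, h (b i) = N) {σ : κ → Prop} {x : E}
    (hx : x ∈ latticeBox b Λ σ) : h x ≤ Fintype.card κ * N := by
  conv_lhs => rw [← b.sum_repr x]
  simp only [map_sum, map_smul, hbN, smul_eq_mul]
  calc ∑ i, b.repr x i * (N : ℝ) ≤ ∑ _i : κ, (N : ℝ) :=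
        Finset.sum_le_sum fun i _ => mul_le_of_le_one_left N.cast_nonneg (hx.2 i).mem_Icc.2
    _ = Fintype.card κ * N := by simp

/-- Translating the box by nonnegative integer combinations of the generators tiles the cone. -/
lemma bijective_latticeBox_add (hbΛ : ∀ i, b i ∈ Λ) (hbN : ∀ i, h (b i) = N)
    (hint : ∀ x ∈ Λ, ∃ n : ℤ, h x = n) (σ : κ → Prop) (t : ℤ) :
    ∃ f : (Σ y : latticeBox b Λ σ, {m : κ → ℕ // ⌊h y.1⌋ + N * ∑ i, (m i : ℤ) = t}) →
      latticeConeSlice b Λ h σ t, Function.Bijective f := by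
  classical
  have hfl : ∀ x ∈ Λ, ((⌊h x⌋ : ℤ) : ℝ) = h x := by
    intro x hx
    obtain ⟨n, hn⟩ := hint x hx
    rw [hn, Int.floor_intCast]
  have hrepr : ∀ (y : E) (m : κ → ℕ) i, b.repr (y + ∑ i, m i • b i) i = b.repr y i + m i := by
    intro y m i
    simp only [map_add, Finsupp.add_apply, map_sum, map_nsmul, b.repr_self,
      Finsupp.finsetSum_apply, Finsupp.smul_apply, Finsupp.single_apply]
    simp
  have hh : ∀ (y : E) (m : κ → ℕ), h (y + ∑ i, m i • b i) = h y + N * ∑ i, (m i : ℝ) := by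
    intro y m
    simp [hbN, Finset.mul_sum, mul_comm]
  have hmem : ∀ p : (Σ y : latticeBox b Λ σ, {m : κ → ℕ // ⌊h y.1⌋ + N * ∑ i, (m i : ℤ) = t}),
      p.1.1 + ∑ i, p.2.1 i • b i ∈ latticeConeSlice b Λ h σ t := by
    rintro ⟨⟨y, hyΛ, hy⟩, m, hm⟩
    refine ⟨Λ.add_mem hyΛ (Λ.sum_mem fun i _ => Λ.nsmul_mem (hbΛ i) _), fun i => ?_, ?_⟩
    · rw [hrepr]; exact (hy i).inRay_add _
    · have hm' : ((⌊h y⌋ + N * ∑ i, (m i : ℤ) : ℤ) : ℝ) = t := congrArg Int.cast hm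
      push_cast at hm'
      rw [hfl y hyΛ] at hm'
      exact (hh y m).trans hm'
  refine ⟨fun p => ⟨_, hmem p⟩, ?_, ?_⟩
  · rintro ⟨⟨y, hyΛ, hy⟩, m, hm⟩ ⟨⟨y', hyΛ', hy'⟩, m', hm'⟩ heq
    have heq' : y + ∑ i, m i • b i = y' + ∑ i, m' i • b i := congrArg Subtype.val heq
    obtain rfl : m = m' := by
      funext i
      refine (hy i).eq_of_add_natCast_eq (hy' i) ?_
      rw [← hrepr, ← hrepr, heq']
    obtain rfl : y = y' := add_right_cancel heq'
    rfl
  · rintro ⟨x, hxΛ, hx, hxt⟩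
    choose m hm using fun i => (hx i).exists_inWindow_sub
    have hyx : (x - ∑ i, m i • b i) + ∑ i, m i • b i = x := sub_add_cancel _ _
    have hyΛ : x - ∑ i, m i • b i ∈ Λ :=
      Λ.sub_mem hxΛ (Λ.sum_mem fun i _ => Λ.nsmul_mem (hbΛ i) _)
    refine ⟨⟨⟨x - ∑ i, m i • b i, hyΛ, fun i => ?_⟩, m, ?_⟩, Subtype.ext hyx⟩
    · have := hrepr (x - ∑ i, m i • b i) m i
      rw [hyx] at this
      rw [show b.repr (x - ∑ i, m i • b i) i = b.repr x i - m i by linarith]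
      exact hm i
    · have := hh (x - ∑ i, m i • b i) m
      rw [hyx, hxt, ← hfl _ hyΛ] at this
      exact_mod_cast this.symm

open Classical Polynomial in
/-- The quasi-polynomial of a half-open simplicial cone. -/
noncomputable def boxPoly (κ : Type*) [Fintype κ] (h : E →ₗ[ℝ] ℝ) (N : ℕ) (B : Finset E)
    (c : ZMod N) : ℚ[X] :=
  ∑ y ∈ B, if ((⌊h y⌋ : ℤ) : ZMod N) = c then
    (choosePoly (Fintype.card κ - 1)).comp (C ((N : ℚ)⁻¹) * (X - C ((⌊h y⌋ : ℤ) : ℚ))) else 0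

open Classical in
lemma eval_boxPoly (B : Finset E) (t : ℤ) :
    (boxPoly κ h N B t).eval (t : ℚ) = ∑ y ∈ B, if ((⌊h y⌋ : ℤ) : ZMod N) = t then
      (choosePoly (Fintype.card κ - 1)).eval (((t : ℚ) - ⌊h y⌋) / N) else 0 := by
  rw [boxPoly, Polynomial.eval_finsetSum]
  refine Finset.sum_congr rfl fun y _ => ?_
  split_ifs <;> simp [div_eq_inv_mul]

lemma natCard_latticeConeSlice [Nonempty κ] (hN : 0 < N) (hbΛ : ∀ i, b i ∈ Λ)
    (hbN : ∀ i, h (b i) = N) (hint : ∀ x ∈ Λ, ∃ n : ℤ, h x = n) (σ : κ → Prop)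
    (hfin : (latticeBox b Λ σ).Finite) {t : ℤ} (ht : 1 ≤ t) :
    (latticeConeSlice b Λ h σ t).Finite ∧
      (boxPoly κ h N hfin.toFinset t).eval (t : ℚ) = Nat.card (latticeConeSlice b Λ h σ t) := by
  classical
  obtain ⟨f, hf⟩ := bijective_latticeBox_add hbΛ hbN hint σ t
  have : Fintype (latticeBox b Λ σ) := hfin.fintype
  have : ∀ y : latticeBox b Λ σ, Finite {m : κ → ℕ // ⌊h y.1⌋ + N * ∑ i, (m i : ℤ) = t} := by
    intro y
    refine Set.Finite.subset (Set.Finite.pi' fun _ : κ => Set.finite_Iic (t - ⌊h y.1⌋).toNat) ?_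
    intro m (hm : ⌊h y.1⌋ + N * ∑ i, (m i : ℤ) = t) i
    have h1 : (m i : ℤ) ≤ ∑ i, (m i : ℤ) :=
      Finset.single_le_sum (f := fun i => (m i : ℤ)) (fun _ _ => by positivity) (Finset.mem_univ i)
    have h2 : (1 : ℤ) ≤ N := by exact_mod_cast hN
    have h3 : (m i : ℤ) ≤ t - ⌊h y.1⌋ := by nlinarith
    simp only [Set.mem_Iic]
    omega
  refine ⟨Set.finite_coe_iff.1 (Finite.of_surjective f hf.2), ?_⟩
  rw [← Nat.card_eq_of_bijective f hf, Nat.card_sigma, eval_boxPoly, Nat.cast_sum]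
  rw [← Finset.sum_subtype hfin.toFinset (fun x => hfin.mem_toFinset)
    (fun y => (Nat.card {m : κ → ℕ // ⌊h y⌋ + N * ∑ i, (m i : ℤ) = t} : ℚ))]
  refine Finset.sum_congr rfl fun y hy => (natCard_add_mul_sum_eq hN ht ?_).symm
  have := (Int.floor_le _).trans (apply_le_of_mem_latticeBox hbN (hfin.mem_toFinset.1 hy))
  exact_mod_cast this

lemma sum_sub_mem_latticeBox (hbΛ : ∀ i, b i ∈ Λ) {σ : κ → Prop} {y : E}
    (hy : y ∈ latticeBox b Λ σ) : ∑ i, b i - y ∈ latticeBox b Λ fun i => ¬ σ i := by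
  classical
  refine ⟨Λ.sub_mem (Λ.sum_mem fun i _ => hbΛ i) hy.1, fun i => ?_⟩
  have : b.repr (∑ i, b i - y) i = 1 - b.repr y i := by
    simp [Finsupp.single_apply]
  rw [this]
  exact (hy.2 i).one_sub

lemma eval_boxPoly_neg [Nonempty κ] (hN : 0 < N) (hbΛ : ∀ i, b i ∈ Λ)
    (hbN : ∀ i, h (b i) = N) (hint : ∀ x ∈ Λ, ∃ n : ℤ, h x = n) {σ : κ → Prop}
    (hfin : (latticeBox b Λ σ).Finite) (hfin' : (latticeBox b Λ fun i => ¬ σ i).Finite) (t : ℤ) :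
    (boxPoly κ h N hfin.toFinset (-t : ℤ)).eval ((-t : ℤ) : ℚ)
      = (-1) ^ (Fintype.card κ - 1) * (boxPoly κ h N hfin'.toFinset t).eval (t : ℚ) := by
  classical
  have hNq : (N : ℚ) ≠ 0 := by positivity
  have hk : 1 ≤ Fintype.card κ := Fintype.card_pos
  rw [eval_boxPoly, eval_boxPoly, Finset.mul_sum]
  refine Finset.sum_nbij' (fun y => ∑ i, b i - y) (fun y => ∑ i, b i - y) ?_ ?_
    (fun y _ => sub_sub_cancel _ _) (fun y _ => sub_sub_cancel _ _) ?_
  · intro y hy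
    exact hfin'.mem_toFinset.2 (sum_sub_mem_latticeBox hbΛ (hfin.mem_toFinset.1 hy))
  · intro y hy
    have := sum_sub_mem_latticeBox hbΛ (hfin'.mem_toFinset.1 hy)
    simp only [not_not] at this
    exact hfin.mem_toFinset.2 this
  · intro y hy
    obtain ⟨n, hn⟩ := hint y (hfin.mem_toFinset.1 hy).1
    have hn' : h (∑ i, b i - y) = ((Fintype.card κ * N - n : ℤ) : ℝ) := by
      simp [hbN, hn]
    rw [hn', hn, Int.floor_intCast, Int.floor_intCast]
    have hiff : ((n : ZMod N) = ((-t : ℤ) : ZMod N)) ↔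
        (((Fintype.card κ * N - n : ℤ) : ZMod N) = t) := by
      push_cast
      rw [ZMod.natCast_self, mul_zero, zero_sub, neg_eq_iff_eq_neg]
    simp only [hiff, mul_ite, mul_zero]
    refine if_congr Iff.rfl ?_ rfl
    rw [← eval_choosePoly_neg]
    congr 1
    rw [Nat.cast_sub hk]
    push_cast
    field_simp
    ring

end HalfOpenCone

/-! ### A generic decomposition of a pointed cone into simplicial cones -/

section IndexBasis

open Module Filter Topology

variable {ι E : Type*} [AddCommGroup E] [Module ℝ E]

/-- The sets of indices on which the family `v` is a basis. -/
def IndexBasis (v : ι → E) : Type _ :=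
  {s : Finset ι // LinearIndepOn ℝ v (s : Set ι) ∧ ⊤ ≤ Submodule.span ℝ (v '' (s : Set ι))}

namespace IndexBasis

variable {v : ι → E} (s : IndexBasis v)

instance [Finite ι] : Finite (IndexBasis v) := by
  have := Fintype.ofFinite ι
  exact inferInstanceAs (Finite {s : Finset ι // _})

/-- The basis given by an element of `IndexBasis`. -/
noncomputable def basis : Basis s.1 ℝ E :=
  Basis.mk (v := fun i : s.1 => v i) s.2.1 (by
    have h := s.2.2
    rwa [Set.image_eq_range] at h)

@[simp]
lemma basis_apply (i : s.1) : s.basis i = v i := Basis.mk_apply _ _ _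

open Classical in
/-- The coordinates in the basis indexed by `s`, extended by zero outside `s`. -/
noncomputable def coord : E →ₗ[ℝ] ι → ℝ :=
  s.basis.constr ℝ fun i => Pi.single (i : ι) (1 : ℝ)

open Classical in
lemma coord_apply_self {i : ι} (hi : i ∈ s.1) : s.coord (v i) = Pi.single i 1 := by
  rw [← s.basis_apply ⟨i, hi⟩, coord, Basis.constr_basis]

lemma coord_apply_of_notMem (z : E) {j : ι} (hj : j ∉ s.1) : s.coord z j = 0 := by
  classical
  suffices LinearMap.proj j ∘ₗ s.coord = 0 from LinearMap.congr_fun this z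
  refine s.basis.ext fun i => ?_
  have : j ≠ i := fun h => hj (h ▸ i.2)
  simp [s.coord_apply_self i.2, this]

lemma coord_eq_repr (z : E) (i : s.1) : s.coord z i = s.basis.repr z i := by
  classical
  suffices LinearMap.proj (i : ι) ∘ₗ s.coord = s.basis.coord i from LinearMap.congr_fun this z
  refine s.basis.ext fun j => ?_
  rw [LinearMap.comp_apply, Basis.coord_apply, s.basis.repr_self, basis_apply,
    s.coord_apply_self j.2, LinearMap.proj_apply, Finsupp.single_apply, Pi.single_apply]
  exact if_congr (by rw [Subtype.ext_iff, eq_comm]) rfl rfl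

variable [Fintype ι]

lemma sum_coord (z : E) : ∑ i, s.coord z i • v i = z := by
  classical
  suffices Fintype.linearCombination ℝ v ∘ₗ s.coord = LinearMap.id from
    LinearMap.congr_fun this z
  refine s.basis.ext fun i => ?_
  simp [s.coord_apply_self i.2]

lemma coord_sum {c : ι → ℝ} (hc : ∀ i ∉ s.1, c i = 0) : s.coord (∑ i, c i • v i) = c := by
  classical
  have : ∀ i, c i • s.coord (v i) = Pi.single i (c i) := by
    intro i
    by_cases hi : i ∈ s.1
    · rw [s.coord_apply_self hi, ← Pi.single_smul, smul_eq_mul, mul_one]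
    · simp [hc i hi]
  simp_rw [map_sum, map_smul, this]
  exact Finset.univ_sum_single c

/-- The cost of `z` in the basis indexed by `s`, each `v i` having cost `w i`. -/
noncomputable def cost (w : ι → ℝ) : E →ₗ[ℝ] ℝ := Fintype.linearCombination ℝ w ∘ₗ s.coord

lemma cost_apply (w : ι → ℝ) (z : E) : s.cost w z = ∑ i, s.coord z i * w i := rfl

lemma cost_apply_self (w : ι → ℝ) {i : ι} (hi : i ∈ s.1) : s.cost w (v i) = w i := by
  classical
  simp [cost, s.coord_apply_self hi]

lemma cost_sum (w : ι → ℝ) (c : ι → ℝ) :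
    s.cost w (∑ i, c i • v i) = ∑ i, c i * s.cost w (v i) := by
  simp

lemma exists_of_linearIndepOn (hspan : Submodule.span ℝ (Set.range v) = ⊤) {t : Set ι}
    (ht : LinearIndepOn ℝ v t) : ∃ s : IndexBasis v, t ⊆ s.1 := by
  classical
  obtain ⟨u, -, htu, hu, hi⟩ := exists_linearIndepOn_extension ht (Set.subset_univ t)
  refine ⟨⟨u.toFinite.toFinset, by simpa using hi, ?_⟩, by simpa using htu⟩
  rw [Set.Finite.coe_toFinset, ← hspan, Submodule.span_le, ← Set.image_univ]
  exact hu

/-- A nonnegative combination can be moved along linear relations, without raising its cost, until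
it is supported in a basis. -/
lemma exists_coord_nonneg_cost_le (hspan : Submodule.span ℝ (Set.range v) = ⊤) {h : E →ₗ[ℝ] ℝ}
    (hpos : ∀ i, 0 < h (v i)) (w : ι → ℝ) (c : ι → ℝ) (hc : 0 ≤ c) :
    ∃ s : IndexBasis v, 0 ≤ s.coord (∑ i, c i • v i) ∧
      s.cost w (∑ i, c i • v i) ≤ ∑ i, c i * w i := by
  classical
  induction hn : (Finset.univ.filter fun i => c i ≠ 0).card using Nat.strong_induction_on
    generalizing c with
  | _ n ih =>
  set S := Finset.univ.filter fun i => c i ≠ 0 with hS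
  have hcS : ∀ i, i ∉ S → c i = 0 := by simp [hS]
  by_cases hli : LinearIndepOn ℝ v (S : Set ι)
  · obtain ⟨s, hs⟩ := exists_of_linearIndepOn hspan hli
    have := s.coord_sum (c := c) fun i hi => hcS i fun hiS => hi (hs hiS)
    exact ⟨s, by rwa [this], by rw [cost_apply, this]⟩
  obtain ⟨g, hg0, hgS, hgne, hgw⟩ : ∃ g : ι → ℝ, ∑ i, g i • v i = 0 ∧ (∀ i ∉ S, g i = 0) ∧
      (∃ i, g i ≠ 0) ∧ ∑ i, g i * w i ≤ 0 := by
    rw [not_linearIndepOn_finset_iff] at hli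
    obtain ⟨f, hf0, i, hiS, hi⟩ := hli
    have hsum : ∑ i, (if i ∈ S then f i else 0) • v i = 0 := by
      simpa [ite_smul, Finset.sum_ite_mem] using hf0
    rcases le_total (∑ i, (if i ∈ S then f i else 0) * w i) 0 with hle | hle
    · exact ⟨fun i => if i ∈ S then f i else 0, hsum, fun j hj => if_neg hj,
        ⟨i, by simpa [hiS] using hi⟩, hle⟩
    · refine ⟨fun i => -(if i ∈ S then f i else 0), ?_, fun j hj => ?_,
        ⟨i, by simpa [hiS] using hi⟩, ?_⟩
      · simp only [neg_smul, Finset.sum_neg_distrib, hsum, neg_zero]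
      · simp [hj]
      · simp only [neg_mul, Finset.sum_neg_distrib]
        linarith
  obtain ⟨i₁, hi₁⟩ : ∃ i, g i < 0 := by
    by_contra! hcon
    have hsum : ∑ i, g i * h (v i) = 0 := by
      simpa using congrArg h hg0
    obtain ⟨i, hi⟩ := hgne
    have := (Finset.sum_eq_zero_iff_of_nonneg fun i _ => mul_nonneg (hcon i) (hpos i).le).1 hsum i
      (Finset.mem_univ i)
    exact hi ((mul_eq_zero.1 this).resolve_right (hpos i).ne')
  obtain ⟨i₀, hi₀, hmin⟩ := Finset.exists_min_image (Finset.univ.filter fun i => g i < 0)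
    (fun i => c i / -g i) ⟨i₁, by simp [hi₁]⟩
  simp only [Finset.mem_filter, Finset.mem_univ, true_and] at hi₀ hmin
  set τ := c i₀ / -g i₀ with hτ
  have hτ0 : 0 ≤ τ := div_nonneg (hc i₀) (by linarith)
  have hc' : 0 ≤ fun i => c i + τ * g i := by
    intro i
    rcases lt_or_ge (g i) 0 with hgi | hgi
    · have := (le_div_iff₀ (by linarith : 0 < -g i)).1 (hmin i hgi)
      simp only [Pi.zero_apply]
      linarith
    · exact add_nonneg (hc i) (mul_nonneg hτ0 hgi)
  have hz : ∑ i, (c i + τ * g i) • v i = ∑ i, c i • v i := by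
    simp_rw [add_smul, Finset.sum_add_distrib, mul_smul, ← Finset.smul_sum, hg0, smul_zero,
      add_zero]
  have hw : ∑ i, (c i + τ * g i) * w i ≤ ∑ i, c i * w i := by
    simp_rw [add_mul, Finset.sum_add_distrib, mul_assoc, ← Finset.mul_sum]
    nlinarith
  have hi₀S : i₀ ∈ S := by
    by_contra hcon
    exact hi₀.ne (hgS i₀ hcon)
  have hlt : (Finset.univ.filter fun i => c i + τ * g i ≠ 0).card < n := by
    rw [← hn]
    refine Finset.card_lt_card (Finset.ssubset_iff_of_subset ?_ |>.2 ⟨i₀, hi₀S, ?_⟩)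
    · intro i hi
      by_contra hiS
      simp [hcS i hiS, hgS i hiS] at hi
    · have : g i₀ ≠ 0 := hi₀.ne
      simp only [Finset.mem_filter, Finset.mem_univ, true_and, not_not, hτ]
      field_simp
      ring
  obtain ⟨s, hs, hsw⟩ := ih _ hlt _ hc' rfl
  rw [hz] at hs hsw
  exact ⟨s, hs, hsw.trans hw⟩

/-- `s` is optimal for the costs `w`: replacing an element of the basis never lowers the cost. -/
def IsOptimal (w : ι → ℝ) : Prop := ∀ j ∉ s.1, s.cost w (v j) < w j

lemma exists_generic_cost (v : ι → E) :
    ∃ w : ι → ℝ, ∀ s : IndexBasis v, ∀ j ∉ s.1, s.cost w (v j) ≠ w j := by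
  classical
  obtain ⟨w, hw⟩ := Module.Dual.exists_forall_ne_zero_of_forall_exists (K := ℝ) (M := ι → ℝ)
    (ι := Σ s : IndexBasis v, {j // j ∉ s.1})
    (fun p => Fintype.linearCombination ℝ (p.1.coord (v p.2.1)) - LinearMap.proj p.2.1)
    (by
      rintro ⟨s, j, hj⟩
      refine ⟨Pi.single j 1, ?_⟩
      simp [s.coord_apply_of_notMem (v j) hj])
  refine ⟨w, fun s j hj heq => hw ⟨s, j, hj⟩ ?_⟩
  simp only [cost_apply] at heq
  simp [Fintype.linearCombination_apply, ← heq, mul_comm]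

lemma eq_of_isOptimal {w : ι → ℝ} {s s' : IndexBasis v} (hs : s.IsOptimal w)
    (hs' : s'.IsOptimal w) {z : E} (hz : ∀ i ∈ s.1, 0 < s.coord z i)
    (hz' : ∀ i ∈ s'.1, 0 < s'.coord z i) : s = s' := by
  have key : ∀ {s s' : IndexBasis v}, s.IsOptimal w → (∀ i ∈ s'.1, 0 < s'.coord z i) →
      s.cost w z ≤ s'.cost w z ∧ (¬ s'.1 ⊆ s.1 → s.cost w z < s'.cost w z) := by
    intro s s' hs hz'
    have hcost : s.cost w z = ∑ i, s'.coord z i * s.cost w (v i) := by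
      conv_lhs => rw [← s'.sum_coord z]
      exact s.cost_sum w _
    have hle : ∀ i, s'.coord z i * s.cost w (v i) ≤ s'.coord z i * w i := by
      intro i
      by_cases hi' : i ∈ s'.1
      · by_cases hi : i ∈ s.1
        · rw [s.cost_apply_self w hi]
        · exact mul_le_mul_of_nonneg_left (hs i hi).le (hz' i hi').le
      · simp [s'.coord_apply_of_notMem z hi']
    rw [hcost, cost_apply]
    refine ⟨Finset.sum_le_sum fun i _ => hle i, fun hsub => ?_⟩
    obtain ⟨i, hi', hi⟩ := Finset.not_subset.1 hsub
    exact Finset.sum_lt_sum (fun i _ => hle i)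
      ⟨i, Finset.mem_univ i, mul_lt_mul_of_pos_left (hs i hi) (hz' i hi')⟩
  obtain ⟨h1, h2⟩ := key hs hz'
  obtain ⟨h3, h4⟩ := key hs' hz
  refine Subtype.ext (Finset.Subset.antisymm ?_ ?_)
  · by_contra hcon
    exact absurd (h4 hcon) h1.not_gt
  · by_contra hcon
    exact absurd (h2 hcon) h3.not_gt

lemma exists_isOptimal (hspan : Submodule.span ℝ (Set.range v) = ⊤) {h : E →ₗ[ℝ] ℝ}
    (hpos : ∀ i, 0 < h (v i)) {w : ι → ℝ}
    (hw : ∀ s : IndexBasis v, ∀ j ∉ s.1, s.cost w (v j) ≠ w j) {z : E}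
    (hz : ∀ s : IndexBasis v, ∀ i ∈ s.1, s.coord z i ≠ 0) {c : ι → ℝ} (hc : 0 ≤ c)
    (hcz : ∑ i, c i • v i = z) : ∃ s : IndexBasis v, s.IsOptimal w ∧ 0 ≤ s.coord z := by
  classical
  have := Fintype.ofFinite (IndexBasis v)
  obtain ⟨s₀, hs₀, -⟩ := exists_coord_nonneg_cost_le hspan hpos w c hc
  rw [hcz] at hs₀
  obtain ⟨s, hs, hmin⟩ := Finset.exists_min_image
    (Finset.univ.filter fun s : IndexBasis v => 0 ≤ s.coord z) (fun s => s.cost w z)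
    ⟨s₀, by simp [hs₀]⟩
  simp only [Finset.mem_filter, Finset.mem_univ, true_and] at hs hmin
  refine ⟨s, fun j hj => (hw s j hj).lt_of_le ?_, hs⟩
  by_contra! hlt
  obtain ⟨ε, hε, hcε⟩ : ∃ ε : ℝ, 0 < ε ∧
      0 ≤ fun i => s.coord z i + ε * ((Pi.single j 1 : ι → ℝ) i - s.coord (v j) i) := by
    have hev : ∀ᶠ ε in 𝓝[>] (0 : ℝ), ∀ i,
        0 ≤ s.coord z i + ε * ((Pi.single j 1 : ι → ℝ) i - s.coord (v j) i) := by
      rw [eventually_all]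
      intro i
      by_cases hi : i ∈ s.1
      · have hzi : 0 < s.coord z i := (hs i).lt_of_ne' (hz s i hi)
        have hcont : Continuous fun ε : ℝ =>
            s.coord z i + ε * ((Pi.single j 1 : ι → ℝ) i - s.coord (v j) i) := by fun_prop
        have := (hcont.tendsto' 0 (s.coord z i) (by simp)).eventually (lt_mem_nhds hzi)
        exact (this.filter_mono nhdsWithin_le_nhds).mono fun ε h => h.le
      · filter_upwards [self_mem_nhdsWithin] with ε (hε : 0 < ε)
        rw [s.coord_apply_of_notMem z hi, s.coord_apply_of_notMem (v j) hi, zero_add, sub_zero]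
        refine mul_nonneg hε.le ?_
        by_cases hij : i = j
        · simp [hij]
        · simp [hij]
    obtain ⟨ε, h1, h2⟩ := (hev.and self_mem_nhdsWithin).exists
    exact ⟨ε, h2, h1⟩
  have hsum : ∑ i, (s.coord z i + ε * ((Pi.single j 1 : ι → ℝ) i - s.coord (v j) i)) • v i = z := by
    simp_rw [add_smul, Finset.sum_add_distrib, mul_smul, sub_smul, ← Finset.smul_sum,
      Finset.sum_sub_distrib, s.sum_coord, Pi.single_apply, ite_smul, one_smul, zero_smul]
    simp
  have hcost : ∑ i, (s.coord z i + ε * ((Pi.single j 1 : ι → ℝ) i - s.coord (v j) i)) * w i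
      = s.cost w z + ε * (w j - s.cost w (v j)) := by
    simp_rw [add_mul, Finset.sum_add_distrib, mul_assoc, sub_mul, ← Finset.mul_sum,
      Finset.sum_sub_distrib, ← cost_apply, Pi.single_apply, ite_mul, one_mul, zero_mul]
    simp
  obtain ⟨s', hs', hle⟩ := exists_coord_nonneg_cost_le hspan hpos w _ hcε
  rw [hsum] at hs' hle
  have := hmin s' hs'
  nlinarith

end IndexBasis

end IndexBasis

section Cone

open Module Filter Topology

lemma InRay.eventually_pos {a b : ℝ} (h : InRay (0 < b) a) :
    ∀ᶠ ε in 𝓝[>] (0 : ℝ), 0 < a + ε * b := by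
  rcases h with h | ⟨hb, rfl⟩
  · have hcont : Continuous fun ε : ℝ => a + ε * b := by fun_prop
    exact ((hcont.tendsto' 0 a (by simp)).eventually (lt_mem_nhds h)).filter_mono
      nhdsWithin_le_nhds
  · filter_upwards [self_mem_nhdsWithin] with ε (hε : 0 < ε)
    rw [zero_add]
    exact mul_pos hε hb

lemma eventually_neg_of_not_inRay {a b : ℝ} (hb : b ≠ 0) (h : ¬ InRay (0 < b) a) :
    ∀ᶠ ε in 𝓝[>] (0 : ℝ), a + ε * b < 0 := by
  have ha : a ≤ 0 := not_lt.1 fun ha => h (Or.inl ha)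
  have hray : InRay (0 < -b) (-a) := by
    rcases ha.eq_or_lt with h0 | h0
    · refine Or.inr ⟨?_, by simp [h0]⟩
      have : ¬ 0 < b := fun hb' => h (Or.inr ⟨hb', h0⟩)
      exact neg_pos.2 (lt_of_le_of_ne (not_lt.1 this) hb)
    · exact Or.inl (by linarith)
  filter_upwards [hray.eventually_pos] with ε hε
  linarith

variable {ι E : Type*} [AddCommGroup E] [Module ℝ E] {v : ι → E}

namespace IndexBasis

lemma eventually_coord_add_smul_pos {s : IndexBasis v} {q x : E}
    (hx : ∀ i : s.1, InRay (0 < s.coord q i) (s.coord x i)) [Finite ι] :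
    ∀ᶠ ε in 𝓝[>] (0 : ℝ), ∀ i ∈ s.1, 0 < s.coord (x + ε • q) i := by
  refine eventually_all.2 fun i => ?_
  by_cases hi : i ∈ s.1
  · filter_upwards [(hx ⟨i, hi⟩).eventually_pos] with ε hε _
    simpa using hε
  · exact Eventually.of_forall fun ε h => absurd h hi

lemma eq_of_isOptimal_of_inRay [Fintype ι] {w : ι → ℝ} {q x : E} {s s' : IndexBasis v}
    (hs : s.IsOptimal w) (hs' : s'.IsOptimal w)
    (hx : ∀ i : s.1, InRay (0 < s.coord q i) (s.coord x i))
    (hx' : ∀ i : s'.1, InRay (0 < s'.coord q i) (s'.coord x i)) : s = s' := by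
  obtain ⟨ε, h1, h2⟩ :=
    ((eventually_coord_add_smul_pos hx).and (eventually_coord_add_smul_pos hx')).exists
  exact eq_of_isOptimal hs hs' h1 h2

lemma exists_isOptimal_inRay [Fintype ι] (hspan : Submodule.span ℝ (Set.range v) = ⊤)
    {h : E →ₗ[ℝ] ℝ} (hpos : ∀ i, 0 < h (v i)) {w : ι → ℝ}
    (hw : ∀ s : IndexBasis v, ∀ j ∉ s.1, s.cost w (v j) ≠ w j) {q x : E}
    (hq : ∀ s : IndexBasis v, ∀ i ∈ s.1, s.coord q i ≠ 0)
    (hx : ∀ᶠ ε in 𝓝[>] (0 : ℝ), ∃ c : ι → ℝ, 0 ≤ c ∧ ∑ i, c i • v i = x + ε • q) :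
    ∃ s : IndexBasis v, s.IsOptimal w ∧
      ∀ i : s.1, InRay (0 < s.coord q i) (s.coord x i) := by
  have hgen : ∀ᶠ ε in 𝓝[>] (0 : ℝ), ∀ s : IndexBasis v, ∀ i ∈ s.1, s.coord (x + ε • q) i ≠ 0 := by
    refine eventually_all.2 fun s => eventually_all.2 fun i => ?_
    by_cases hi : i ∈ s.1
    · by_cases hray : InRay (0 < s.coord q i) (s.coord x i)
      · filter_upwards [hray.eventually_pos] with ε hε _
        simpa using hε.ne'
      · filter_upwards [eventually_neg_of_not_inRay (hq s i hi) hray] with ε hε _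
        simpa using hε.ne
    · exact Eventually.of_forall fun ε h => absurd h hi
  by_contra! hcon
  have hout : ∀ᶠ ε in 𝓝[>] (0 : ℝ), ∀ s : IndexBasis v, s.IsOptimal w →
      ¬ 0 ≤ s.coord (x + ε • q) := by
    refine eventually_all.2 fun s => ?_
    by_cases hs : s.IsOptimal w
    · obtain ⟨i, hi⟩ := hcon s hs
      filter_upwards [eventually_neg_of_not_inRay (hq s i i.2) hi] with ε hε _ hle
      have h0 := hle i
      simp only [map_add, map_smul, Pi.zero_apply, Pi.add_apply, Pi.smul_apply, smul_eq_mul] at h0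
      exact hε.not_ge h0
    · exact Eventually.of_forall fun ε h => absurd h hs
  obtain ⟨ε, ⟨c, hc, hcx⟩, hg, ho⟩ := (hx.and (hgen.and hout)).exists
  obtain ⟨s, hs, hs0⟩ := exists_isOptimal hspan hpos hw hg hc hcx
  exact ho s hs hs0

/-- There is a positive combination of the generators with no vanishing coordinate. -/
lemma exists_generic_pos [Fintype ι] (hspan : Submodule.span ℝ (Set.range v) = ⊤) :
    ∃ a : ι → ℝ, (∀ i, 0 < a i) ∧
      ∀ s : IndexBasis v, ∀ i ∈ s.1, s.coord (∑ j, a j • v j) i ≠ 0 := by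
  classical
  obtain ⟨q, hq⟩ := Module.Dual.exists_forall_ne_zero_of_forall_exists (K := ℝ) (M := E)
    (ι := Σ s : IndexBasis v, s.1) (fun p => LinearMap.proj (p.2 : ι) ∘ₗ p.1.coord)
    (by
      rintro ⟨s, i, hi⟩
      exact ⟨v i, by simp [s.coord_apply_self hi]⟩)
  obtain ⟨c, rfl⟩ : ∃ c : ι → ℝ, ∑ i, c i • v i = q := by
    have : q ∈ Submodule.span ℝ (Set.range v) := hspan ▸ Submodule.mem_top
    exact (Submodule.mem_span_range_iff_exists_fun ℝ).1 this
  have hpos : ∀ᶠ ε in 𝓝[>] (0 : ℝ), ∀ i, 0 < 1 + ε * c i :=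
    eventually_all.2 fun i => InRay.eventually_pos (Or.inl one_pos)
  have hgen : ∀ᶠ ε in 𝓝[>] (0 : ℝ), ∀ s : IndexBasis v, ∀ i ∈ s.1,
      s.coord (∑ j, v j) i + ε * s.coord (∑ j, c j • v j) i ≠ 0 := by
    refine eventually_all.2 fun s => eventually_all.2 fun i => ?_
    by_cases hi : i ∈ s.1
    · by_cases hray : InRay (0 < s.coord (∑ j, c j • v j) i) (s.coord (∑ j, v j) i)
      · exact hray.eventually_pos.mono fun ε hε _ => hε.ne'
      · exact (eventually_neg_of_not_inRay (hq ⟨s, i, hi⟩) hray).mono fun ε hε _ => hε.ne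
    · exact Eventually.of_forall fun ε h => absurd h hi
  obtain ⟨ε, h1, h2⟩ := (hpos.and hgen).exists
  refine ⟨fun i => 1 + ε * c i, h1, fun s i hi => ?_⟩
  convert h2 s i hi using 1
  simp_rw [add_smul, Finset.sum_add_distrib, one_smul, mul_smul, ← Finset.smul_sum, map_add,
    map_smul]
  rfl

variable [Fintype ι]

/-- The closed cone is the disjoint union of half-open simplicial cones, a facet being kept when
`q` is on its inner side. -/
lemma exists_nonneg_sum_iff (hspan : Submodule.span ℝ (Set.range v) = ⊤)
    {h : E →ₗ[ℝ] ℝ} (hpos : ∀ i, 0 < h (v i)) {w : ι → ℝ}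
    (hw : ∀ s : IndexBasis v, ∀ j ∉ s.1, s.cost w (v j) ≠ w j) {a : ι → ℝ} (ha : ∀ i, 0 < a i)
    (hq : ∀ s : IndexBasis v, ∀ i ∈ s.1, s.coord (∑ j, a j • v j) i ≠ 0) (x : E) :
    (∃ c : ι → ℝ, 0 ≤ c ∧ ∑ i, c i • v i = x) ↔ ∃ s : IndexBasis v, s.IsOptimal w ∧
      ∀ i : s.1, InRay (0 < s.coord (∑ j, a j • v j) i) (s.coord x i) := by
  constructor
  · rintro ⟨c, hc, rfl⟩
    refine exists_isOptimal_inRay hspan hpos hw hq ?_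
    filter_upwards [self_mem_nhdsWithin] with ε (hε : 0 < ε)
    refine ⟨fun i => c i + ε * a i, fun i => add_nonneg (hc i) (mul_pos hε (ha i)).le, ?_⟩
    simp_rw [add_smul, Finset.sum_add_distrib, mul_smul, ← Finset.smul_sum]
  · rintro ⟨s, -, hs⟩
    refine ⟨s.coord x, fun i => ?_, s.sum_coord x⟩
    by_cases hi : i ∈ s.1
    · rcases hs ⟨i, hi⟩ with h | h
      · exact h.le
      · exact h.2.ge
    · exact (s.coord_apply_of_notMem x hi).ge

/-- The open cone is the disjoint union of half-open simplicial cones, a facet being kept when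
`q` is on its outer side. -/
lemma exists_pos_sum_iff (hspan : Submodule.span ℝ (Set.range v) = ⊤)
    {h : E →ₗ[ℝ] ℝ} (hpos : ∀ i, 0 < h (v i)) {w : ι → ℝ}
    (hw : ∀ s : IndexBasis v, ∀ j ∉ s.1, s.cost w (v j) ≠ w j) {a : ι → ℝ} (ha : ∀ i, 0 < a i)
    (hq : ∀ s : IndexBasis v, ∀ i ∈ s.1, s.coord (∑ j, a j • v j) i ≠ 0) (x : E) :
    (∃ c : ι → ℝ, (∀ i, 0 < c i) ∧ ∑ i, c i • v i = x) ↔ ∃ s : IndexBasis v, s.IsOptimal w ∧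
      ∀ i : s.1, InRay (0 < s.coord (-∑ j, a j • v j) i) (s.coord x i) := by
  constructor
  · rintro ⟨c, hc, rfl⟩
    refine exists_isOptimal_inRay hspan hpos hw (fun s i hi => by simpa using hq s i hi) ?_
    have : ∀ᶠ ε in 𝓝[>] (0 : ℝ), ∀ i, 0 < c i + ε * -a i :=
      eventually_all.2 fun i => InRay.eventually_pos (Or.inl (hc i))
    filter_upwards [this] with ε hε
    refine ⟨fun i => c i + ε * -a i, fun i => (hε i).le, ?_⟩
    simp_rw [add_smul, Finset.sum_add_distrib, mul_smul, neg_smul, ← Finset.smul_sum,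
      Finset.sum_neg_distrib]
  · rintro ⟨s, -, hs⟩
    obtain ⟨ε, h1, hε⟩ := ((eventually_coord_add_smul_pos hs).and self_mem_nhdsWithin).exists
    replace hε : 0 < ε := hε
    set y := x + ε • -∑ j, a j • v j with hy
    refine ⟨fun i => s.coord y i + ε * a i, fun i => ?_, ?_⟩
    · refine add_pos_of_nonneg_of_pos ?_ (mul_pos hε (ha i))
      by_cases hi : i ∈ s.1
      · exact (h1 i hi).le
      · exact (s.coord_apply_of_notMem y hi).ge
    · simp_rw [add_smul, Finset.sum_add_distrib, mul_smul, ← Finset.smul_sum, s.sum_coord, hy]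
      simp

end IndexBasis

lemma natCard_eq_sum_of_existsUnique {α T : Type*} [Fintype T] {A : Set α} {S : T → Set α}
    (hfin : ∀ s, (S s).Finite) (hA : ∀ x, x ∈ A ↔ ∃ s, x ∈ S s)
    (huniq : ∀ x s s', x ∈ S s → x ∈ S s' → s = s') :
    Nat.card A = ∑ s, Nat.card (S s) := by
  have : ∀ s, Finite (S s) := fun s => (hfin s).to_subtype
  rw [← Nat.card_sigma]
  refine (Nat.card_eq_of_bijective
    (fun p : Σ s, S s => (⟨p.2.1, (hA _).2 ⟨p.1, p.2.2⟩⟩ : A)) ⟨?_, ?_⟩).symm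
  · rintro ⟨s, x, hx⟩ ⟨s', x', hx'⟩ heq
    obtain rfl : x = x' := congrArg Subtype.val heq
    obtain rfl := huniq x s s' hx hx'
    rfl
  · rintro ⟨x, hx⟩
    obtain ⟨s, hs⟩ := (hA x).1 hx
    exact ⟨⟨s, x, hs⟩, rfl⟩

open Polynomial in
/-- Ehrhart quasi-polynomials and reciprocity for the cone generated by lattice vectors `v i` of
the same height `N`. -/
theorem exists_quasipolynomial_cone [Fintype ι] [Nonempty ι]
    (hspan : Submodule.span ℝ (Set.range v) = ⊤) {Λ : AddSubgroup E} {h : E →ₗ[ℝ] ℝ} {N : ℕ}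
    (hN : 0 < N) (hvΛ : ∀ i, v i ∈ Λ) (hvN : ∀ i, h (v i) = N)
    (hint : ∀ x ∈ Λ, ∃ n : ℤ, h x = n)
    (hfin : {x | x ∈ Λ ∧ ∃ c : ι → ℝ, (∀ i, c i ∈ Set.Icc 0 1) ∧ ∑ i, c i • v i = x}.Finite) :
    ∃ p : ZMod N → ℚ[X], ∀ t : ℤ, 1 ≤ t →
      (p t).eval (t : ℚ)
        = Nat.card {x | x ∈ Λ ∧ (∃ c : ι → ℝ, 0 ≤ c ∧ ∑ i, c i • v i = x) ∧ h x = t} ∧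
      (-1) ^ (finrank ℝ E - 1) * (p (-t : ℤ)).eval ((-t : ℤ) : ℚ)
        = Nat.card {x | x ∈ Λ ∧ (∃ c : ι → ℝ, (∀ i, 0 < c i) ∧ ∑ i, c i • v i = x) ∧ h x = t} := by
  classical
  have hpos : ∀ i, 0 < h (v i) := fun i => by rw [hvN]; exact_mod_cast hN
  obtain ⟨w, hw⟩ := IndexBasis.exists_generic_cost v
  obtain ⟨a, ha, hq⟩ := IndexBasis.exists_generic_pos hspan
  set q := ∑ j, a j • v j
  have : Nontrivial E := by
    obtain ⟨i⟩ := ‹Nonempty ι›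
    refine ⟨v i, 0, fun h0 => (hpos i).ne' ?_⟩
    rw [h0, map_zero]
  have hne : ∀ s : IndexBasis v, Nonempty s.1 := fun s => s.basis.index_nonempty
  have hcard : ∀ s : IndexBasis v, Fintype.card s.1 = finrank ℝ E := fun s =>
    (finrank_eq_card_basis s.basis).symm
  have hbΛ : ∀ (s : IndexBasis v) i, s.basis i ∈ Λ := fun s i => by simpa using hvΛ i
  have hbN : ∀ (s : IndexBasis v) i, h (s.basis i) = N := fun s i => by simpa using hvN i
  have hbox : ∀ (s : IndexBasis v) (σ : s.1 → Prop), (latticeBox s.basis Λ σ).Finite := by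
    intro s σ
    refine hfin.subset fun x hx => ⟨hx.1, s.coord x, fun i => ?_, s.sum_coord x⟩
    by_cases hi : i ∈ s.1
    · rw [s.coord_eq_repr x ⟨i, hi⟩]
      exact (hx.2 ⟨i, hi⟩).mem_Icc
    · simp [s.coord_apply_of_notMem x hi]
  have := Fintype.ofFinite {s : IndexBasis v // s.IsOptimal w}
  refine ⟨fun c => ∑ s : {s : IndexBasis v // s.IsOptimal w},
    boxPoly s.1.1 h N (hbox s.1 fun i => 0 < s.1.coord q i).toFinset c, fun t ht => ⟨?_, ?_⟩⟩
  · rw [Polynomial.eval_finsetSum, natCard_eq_sum_of_existsUnique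
      (S := fun s : {s : IndexBasis v // s.IsOptimal w} =>
        latticeConeSlice s.1.basis Λ h (fun i => 0 < s.1.coord q i) t), Nat.cast_sum]
    · exact Finset.sum_congr rfl fun s _ =>
        (natCard_latticeConeSlice hN (hbΛ s.1) (hbN s.1) hint _ _ ht).2
    · exact fun s => (natCard_latticeConeSlice hN (hbΛ s.1) (hbN s.1) hint _ (hbox _ _) ht).1
    · intro x
      simp only [Set.mem_ofPred_eq, latticeConeSlice, ← IndexBasis.coord_eq_repr,
        IndexBasis.exists_nonneg_sum_iff hspan hpos hw ha hq x]
      constructor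
      · rintro ⟨h1, ⟨s, hs, h2⟩, h3⟩
        exact ⟨⟨s, hs⟩, h1, h2, h3⟩
      · rintro ⟨⟨s, hs⟩, h1, h2, h3⟩
        exact ⟨h1, ⟨s, hs, h2⟩, h3⟩
    · rintro x s s' ⟨-, hs, -⟩ ⟨-, hs', -⟩
      simp only [← IndexBasis.coord_eq_repr] at hs hs'
      exact Subtype.ext (IndexBasis.eq_of_isOptimal_of_inRay s.2 s'.2 hs hs')
  · have hσ : ∀ (s : IndexBasis v) (i : s.1), (¬ 0 < s.coord q i) = (0 < s.coord (-q) i) := by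
      intro s i
      simp only [map_neg, Pi.neg_apply, Left.neg_pos_iff, not_lt]
      exact propext ⟨fun hle => hle.lt_of_ne (hq s i i.2), le_of_lt⟩
    rw [Polynomial.eval_finsetSum, natCard_eq_sum_of_existsUnique
      (S := fun s : {s : IndexBasis v // s.IsOptimal w} =>
        latticeConeSlice s.1.basis Λ h (fun i => ¬ 0 < s.1.coord q i) t), Nat.cast_sum,
      Finset.mul_sum]
    · refine Finset.sum_congr rfl fun s _ => ?_
      rw [← (natCard_latticeConeSlice hN (hbΛ s.1) (hbN s.1) hint _ (hbox _ _) ht).2,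
        eval_boxPoly_neg hN (hbΛ s.1) (hbN s.1) hint _ (hbox _ _), hcard, ← mul_assoc, ← mul_pow]
      simp
    · exact fun s => (natCard_latticeConeSlice hN (hbΛ s.1) (hbN s.1) hint _ (hbox _ _) ht).1
    · intro x
      simp only [Set.mem_ofPred_eq, latticeConeSlice, ← IndexBasis.coord_eq_repr, hσ,
        IndexBasis.exists_pos_sum_iff hspan hpos hw ha hq x]
      constructor
      · rintro ⟨h1, ⟨s, hs, h2⟩, h3⟩
        exact ⟨⟨s, hs⟩, h1, h2, h3⟩
      · rintro ⟨⟨s, hs⟩, h1, h2, h3⟩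
        exact ⟨h1, ⟨s, hs, h2⟩, h3⟩
    · rintro x s s' ⟨-, hs, -⟩ ⟨-, hs', -⟩
      simp only [hσ, ← IndexBasis.coord_eq_repr] at hs hs'
      exact Subtype.ext (IndexBasis.eq_of_isOptimal_of_inRay s.2 s'.2 hs hs')

end Cone

/-! ### Relative interiors of polytopes -/

section Polytope

open Module

variable {ι F : Type*} [Fintype ι]

lemma mem_convexHull_range_iff [AddCommGroup F] [Module ℝ F] (f : ι → F) (x : F) :
    x ∈ convexHull ℝ (Set.range f) ↔
      ∃ c : ι → ℝ, 0 ≤ c ∧ ∑ i, c i = 1 ∧ ∑ i, c i • f i = x := by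
  classical
  constructor
  · intro hx
    refine convexHull_min (t := {x | ∃ c : ι → ℝ, 0 ≤ c ∧ ∑ i, c i = 1 ∧ ∑ i, c i • f i = x})
      ?_ ?_ hx
    · rintro _ ⟨i, rfl⟩
      exact ⟨Pi.single i 1, Pi.single_nonneg.2 zero_le_one, by simp, by simp [Pi.single_apply]⟩
    · rintro _ ⟨c, hc, hc1, rfl⟩ _ ⟨b, hb, hb1, rfl⟩ s t hs ht hst
      refine ⟨s • c + t • b, add_nonneg (smul_nonneg hs hc) (smul_nonneg ht hb), ?_, ?_⟩
      · simp [Finset.sum_add_distrib, ← Finset.mul_sum, hc1, hb1, hst]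
      · simp [Finset.sum_add_distrib, Finset.smul_sum, add_smul, mul_smul]
  · rintro ⟨c, hc, hc1, rfl⟩
    exact (convex_convexHull ℝ _).sum_mem (fun i _ => hc i) hc1
      fun i _ => subset_convexHull ℝ _ (Set.mem_range_self i)

lemma mem_intrinsicInterior_iff_dist [SeminormedAddCommGroup F] [Module ℝ F] {s : Set F} {x : F} :
    x ∈ intrinsicInterior ℝ s ↔ x ∈ affineSpan ℝ s ∧
      ∃ δ > 0, ∀ y ∈ affineSpan ℝ s, dist y x < δ → y ∈ s := by
  simp only [mem_intrinsicInterior, mem_interior_iff_mem_nhds, Metric.mem_nhds_iff]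
  constructor
  · rintro ⟨y, ⟨δ, hδ, h⟩, rfl⟩
    exact ⟨y.2, δ, hδ, fun z hz hzy => @h ⟨z, hz⟩ hzy⟩
  · rintro ⟨hx, δ, hδ, h⟩
    exact ⟨⟨x, hx⟩, ⟨δ, hδ, fun z hz => h z z.2 hz⟩, rfl⟩

/-- The relative interior of a polytope consists of the strictly positive convex combinations of
any generating family. -/
lemma mem_intrinsicInterior_convexHull_range_iff [Nonempty ι] [NormedAddCommGroup F]
    [NormedSpace ℝ F] [FiniteDimensional ℝ F] (f : ι → F) (x : F) :
    x ∈ intrinsicInterior ℝ (convexHull ℝ (Set.range f)) ↔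
      ∃ c : ι → ℝ, (∀ i, 0 < c i) ∧ ∑ i, c i = 1 ∧ ∑ i, c i • f i = x := by
  set P := convexHull ℝ (Set.range f) with hP
  constructor
  · intro hx
    obtain ⟨hxP, δ, hδ, hball⟩ := mem_intrinsicInterior_iff_dist.1 hx
    have hn : (0 : ℝ) < Fintype.card ι := by exact_mod_cast Fintype.card_pos
    set m : F := ∑ i, (Fintype.card ι : ℝ)⁻¹ • f i with hm
    have hmP : m ∈ P := (mem_convexHull_range_iff f m).2
      ⟨fun _ => (Fintype.card ι : ℝ)⁻¹, fun _ => by positivity, by simp, rfl⟩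
    obtain ⟨ε, hε, hεδ⟩ := exists_pos_mul_lt hδ ‖x - m‖
    have hy : x + ε • (x - m) ∈ P := by
      refine hball _ ?_ ?_
      · rw [add_comm]
        exact AffineSubspace.vadd_mem_of_mem_direction (Submodule.smul_mem _ _
          (AffineSubspace.vsub_mem_direction hxP (subset_affineSpan ℝ _ hmP))) hxP
      · rwa [dist_eq_norm, add_sub_cancel_left, norm_smul, Real.norm_of_nonneg hε.le, mul_comm]
    obtain ⟨b, hb, hb1, hbx⟩ := (mem_convexHull_range_iff f _).1 hy
    refine ⟨fun i => (1 + ε)⁻¹ * (b i + ε * (Fintype.card ι : ℝ)⁻¹), fun i => ?_, ?_, ?_⟩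
    · have := hb i
      simp only [Pi.zero_apply] at this
      positivity
    · rw [← Finset.mul_sum, Finset.sum_add_distrib, hb1]
      simp only [Finset.sum_const, Finset.card_univ, nsmul_eq_mul]
      field_simp
    · simp only [mul_smul, add_smul, ← Finset.smul_sum, Finset.sum_add_distrib, hbx, ← hm]
      rw [inv_smul_eq_iff₀ (by positivity)]
      module
  · rintro ⟨c, hc, hc1, rfl⟩
    obtain ⟨p, hp⟩ := Set.Nonempty.intrinsicInterior (convex_convexHull ℝ (Set.range f))
      (Set.range_nonempty f).convexHull
    obtain ⟨b, hb, hb1, hbp⟩ := (mem_convexHull_range_iff f p).1 (intrinsicInterior_subset hp)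
    obtain ⟨hpP, δ, hδ, hball⟩ := mem_intrinsicInterior_iff_dist.1 hp
    obtain ⟨i₀, hi₀⟩ := Finite.exists_min c
    set ε := c i₀
    have hε : 0 < ε := hc i₀
    set x := ∑ i, c i • f i with hx
    have hxP : x ∈ affineSpan ℝ P := subset_affineSpan ℝ _
      ((mem_convexHull_range_iff f x).2 ⟨c, fun i => (hc i).le, hc1, rfl⟩)
    have hy : x + ε • (x - p) ∈ P := by
      refine (mem_convexHull_range_iff f _).2 ⟨fun i => c i + ε * (c i - b i), fun i => ?_, ?_, ?_⟩
      · have hb' : b i ≤ 1 := hb1 ▸ Finset.single_le_sum (fun j _ => hb j) (Finset.mem_univ i)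
        have := hi₀ i
        have := mul_le_mul_of_nonneg_left hb' hε.le
        have := mul_pos hε (hc i)
        simp only [Pi.zero_apply]
        linarith
      · simp [Finset.sum_add_distrib, ← Finset.mul_sum, hb1, hc1]
      · simp only [add_smul, mul_smul, sub_smul, Finset.sum_add_distrib, ← Finset.smul_sum,
          Finset.sum_sub_distrib, hbp, ← hx]
    refine mem_intrinsicInterior_iff_dist.2 ⟨hxP, ε / (1 + ε) * δ, by positivity, fun z hz hzx => ?_⟩
    have hw : ((1 + ε) / ε) • (z - x) + p ∈ P := by
      refine hball _ (AffineSubspace.vadd_mem_of_mem_direction (Submodule.smul_mem _ _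
          (AffineSubspace.vsub_mem_direction hz hxP)) hpP) ?_
      rw [dist_eq_norm, add_sub_cancel_right, norm_smul, Real.norm_of_nonneg (by positivity),
        ← dist_eq_norm]
      rw [div_mul_eq_mul_div, lt_div_iff₀ (by positivity)] at hzx
      rw [div_mul_eq_mul_div, div_lt_iff₀ hε]
      linarith
    convert convex_convexHull ℝ (Set.range f) hy hw (a := 1 / (1 + ε)) (b := ε / (1 + ε))
      (by positivity) (by positivity) (by field_simp) using 1
    have h1 : ε / (1 + ε) * ((1 + ε) / ε) = 1 := by field_simp
    have h3 : ε / (1 + ε) = ε * (1 / (1 + ε)) := by field_simp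
    rw [smul_add (ε / (1 + ε)), smul_smul, h1, one_smul, h3]
    have h4 : (1 / (1 + ε)) • (x + ε • (x - p)) = x - (ε * (1 / (1 + ε))) • p := by
      have : x + ε • (x - p) = (1 + ε) • x - ε • p := by module
      rw [this, smul_sub, smul_smul, smul_smul, one_div_mul_cancel (by positivity), one_smul,
        mul_comm ε]
    rw [h4]
    abel

end Polytope

/-! ### The cone over a rational polytope -/

section Homogenization

open Module

variable {ι G : Type*} [AddCommGroup G] [Module ℝ G]

/-- The generators at height `a` of the cone over the polytope generated by `f`. -/
def coneGenerator (f : ι → G) (a : ℝ) (i : ι) : G × ℝ := (a • f i, a)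

lemma finrank_span_coneGenerator [Nonempty ι] [FiniteDimensional ℝ G] (f : ι → G) {a : ℝ}
    (ha : a ≠ 0) :
    finrank ℝ (Submodule.span ℝ (Set.range (coneGenerator f a))) =
      finrank ℝ (vectorSpan ℝ (Set.range f)) + 1 := by
  let i₀ : ι := Classical.arbitrary ι
  let ψ : vectorSpan ℝ (Set.range f) × ℝ →ₗ[ℝ] G × ℝ :=
    ((vectorSpan ℝ (Set.range f)).subtype.coprod (LinearMap.toSpanSingleton ℝ G (f i₀))).prod
      (LinearMap.snd ℝ _ _)
  have hψ : ∀ w r, ψ (w, r) = ((w : G) + r • f i₀, r) := fun w r => by simp [ψ]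
  have hinj : Function.Injective ψ := by
    rintro ⟨w, r⟩ ⟨w', r'⟩ heq
    rw [hψ, hψ, Prod.mk.injEq] at heq
    obtain ⟨h1, rfl⟩ := heq
    simpa using h1
  have hmem : ∀ i, coneGenerator f a i ∈ Submodule.span ℝ (Set.range (coneGenerator f a)) :=
    fun i => Submodule.subset_span (Set.mem_range_self i)
  have hrange : LinearMap.range ψ = Submodule.span ℝ (Set.range (coneGenerator f a)) := by
    refine le_antisymm ?_ (Submodule.span_le.2 ?_)
    · have hbase : (f i₀, (1 : ℝ)) ∈ Submodule.span ℝ (Set.range (coneGenerator f a)) := by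
        simpa [coneGenerator, smul_smul, ha] using Submodule.smul_mem _ a⁻¹ (hmem i₀)
      have hdir : vectorSpan ℝ (Set.range f) ≤
          (Submodule.span ℝ (Set.range (coneGenerator f a))).comap (LinearMap.inl ℝ G ℝ) := by
        rw [vectorSpan_range_eq_span_range_vsub_right ℝ f i₀, Submodule.span_le]
        rintro _ ⟨i, rfl⟩
        simpa [coneGenerator, smul_smul, ha, smul_sub] using
          Submodule.smul_mem _ a⁻¹ (Submodule.sub_mem _ (hmem i) (hmem i₀))
      rintro _ ⟨⟨w, r⟩, rfl⟩
      have := Submodule.add_mem _ (Submodule.mem_comap.1 (hdir w.2)) (Submodule.smul_mem _ r hbase)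
      simpa [hψ] using this
    · rintro _ ⟨i, rfl⟩
      refine ⟨(a • ⟨f i - f i₀, vsub_mem_vectorSpan ℝ (Set.mem_range_self i)
        (Set.mem_range_self i₀)⟩, a), ?_⟩
      rw [hψ]
      simp [coneGenerator, smul_sub]
  rw [← hrange, LinearMap.finrank_range_of_inj hinj, finrank_prod, finrank_self]

lemma mem_smul_iff_exists_sum_coneGenerator [Fintype ι] {f : ι → G} {a t : ℝ} (ha : 0 < a)
    (ht : 0 < t) {R : (ι → ℝ) → Prop} (hR : ∀ r : ℝ, 0 < r → ∀ c, R c → R (r • c)) {S : Set G}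
    (hS : ∀ x, x ∈ S ↔ ∃ c, R c ∧ ∑ i, c i = 1 ∧ ∑ i, c i • f i = x) (z : G) :
    z ∈ t • S ↔ ∃ c, R c ∧ ∑ i, c i • coneGenerator f a i = (z, t) := by
  have hsum : ∀ c : ι → ℝ, ∑ i, c i • coneGenerator f a i
      = (a • ∑ i, c i • f i, (∑ i, c i) * a) := fun c => by
    simp [Prod.ext_iff, coneGenerator, Finset.smul_sum, Finset.sum_mul, Prod.fst_sum,
      Prod.snd_sum, smul_comm a]
  have hscale : ∀ (r : ℝ) (c : ι → ℝ), ∑ i, (r • c) i • f i = r • ∑ i, c i • f i := fun r c => by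
    simp [Finset.smul_sum, mul_smul]
  simp only [hsum, Prod.mk.injEq]
  rw [Set.mem_smul_set_iff_inv_smul_mem₀ ht.ne', hS]
  constructor
  · rintro ⟨c, hc, hc1, hz⟩
    refine ⟨(t / a) • c, hR _ (by positivity) _ hc, ?_, ?_⟩
    · rw [hscale, hz, smul_smul, smul_smul, mul_div_cancel₀ _ ha.ne', mul_inv_cancel₀ ht.ne',
        one_smul]
    · simp only [Pi.smul_apply, smul_eq_mul, ← Finset.mul_sum, hc1]
      field_simp
  · rintro ⟨c, hc, hz, hct⟩
    refine ⟨(a / t) • c, hR _ (by positivity) _ hc, ?_, ?_⟩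
    · simp only [Pi.smul_apply, smul_eq_mul, ← Finset.mul_sum]
      rw [div_mul_eq_mul_div, mul_comm, hct, div_self ht.ne']
    · rw [hscale, ← hz, smul_smul, div_eq_inv_mul]

end Homogenization

section LatticePoints

/-- The points of `ℝ^d × ℝ` with integer coordinates. -/
def integerPoints (d : ℕ) : AddSubgroup ((Fin d → ℝ) × ℝ) :=
  (AddSubgroup.pi Set.univ fun _ => (Int.castAddHom ℝ).range).prod (Int.castAddHom ℝ).range

lemma mem_integerPoints {d : ℕ} {x : (Fin d → ℝ) × ℝ} :
    x ∈ integerPoints d ↔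
      ∃ (n : Fin d → ℤ) (m : ℤ), x = (fun j => (n j : ℝ), (m : ℝ)) := by
  simp only [integerPoints, AddSubgroup.mem_prod, AddSubgroup.mem_pi, Set.mem_univ, true_imp_iff,
    AddMonoidHom.mem_range, Int.coe_castAddHom]
  constructor
  · rintro ⟨h1, m, hm⟩
    choose n hn using h1
    exact ⟨n, m, Prod.ext (funext fun j => (hn j).symm) hm.symm⟩
  · rintro ⟨n, m, rfl⟩
    exact ⟨fun j => ⟨n j, rfl⟩, m, rfl⟩

lemma finite_integerPoints_norm_le (d : ℕ) (B : ℝ) :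
    {x | x ∈ integerPoints d ∧ ‖x‖ ≤ B}.Finite := by
  classical
  have habs : ∀ n : ℤ, |(n : ℝ)| ≤ B → -⌈B⌉ ≤ n ∧ n ≤ ⌈B⌉ := fun n hn => by
    have h := abs_le.1 (hn.trans (Int.le_ceil B))
    exact ⟨by exact_mod_cast h.1, by exact_mod_cast h.2⟩
  refine ((Set.finite_Icc (fun _ => -⌈B⌉, -⌈B⌉) (fun _ => ⌈B⌉, ⌈B⌉)).image
    fun y : (Fin d → ℤ) × ℤ => ((fun j => (y.1 j : ℝ), (y.2 : ℝ)) : (Fin d → ℝ) × ℝ)).subset ?_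
  rintro x ⟨hx, hxB⟩
  obtain ⟨n, m, rfl⟩ := mem_integerPoints.1 hx
  have hn : ∀ j, |(n j : ℝ)| ≤ B := fun j =>
    (norm_le_pi_norm (fun j => (n j : ℝ)) j).trans ((norm_fst_le _).trans hxB)
  have hm : |(m : ℝ)| ≤ B := (norm_snd_le (_, (m : ℝ))).trans hxB
  exact ⟨(n, m), ⟨⟨fun j => (habs _ (hn j)).1, (habs _ hm).1⟩,
    ⟨fun j => (habs _ (hn j)).2, (habs _ hm).2⟩⟩, rfl⟩

lemma finite_integerPoints_sum_Icc {ι : Type*} [Fintype ι] {d : ℕ} (u : ι → (Fin d → ℝ) × ℝ) :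
    {x | x ∈ integerPoints d ∧
      ∃ c : ι → ℝ, (∀ i, c i ∈ Set.Icc 0 1) ∧ ∑ i, c i • u i = x}.Finite := by
  refine (finite_integerPoints_norm_le d (∑ i, ‖u i‖)).subset ?_
  rintro _ ⟨hx, c, hc, rfl⟩
  refine ⟨hx, (norm_sum_le _ _).trans (Finset.sum_le_sum fun i _ => ?_)⟩
  rw [norm_smul, Real.norm_of_nonneg (hc i).1]
  exact mul_le_of_le_one_left (norm_nonneg _) (hc i).2

lemma natCard_integer_eq_natCard_cone {ι : Type*} [Fintype ι] {d : ℕ}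
    (u : ι → (Fin d → ℝ) × ℝ) (R : (ι → ℝ) → Prop) {S : Set (Fin d → ℝ)} {t : ℤ}
    (hS : ∀ z, z ∈ S ↔ ∃ c, R c ∧ ∑ i, c i • u i = (z, (t : ℝ))) :
    Nat.card {x : Fin d → ℤ | (fun j => (x j : ℝ)) ∈ S} =
      Nat.card {y : Submodule.span ℝ (Set.range u) | (y : (Fin d → ℝ) × ℝ) ∈ integerPoints d ∧
        (∃ c, R c ∧ ∑ i, c i • (⟨u i, Submodule.subset_span (Set.mem_range_self i)⟩ :
          Submodule.span ℝ (Set.range u)) = y) ∧ (y : (Fin d → ℝ) × ℝ).2 = t} := by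
  have hcoe : ∀ (c : ι → ℝ) (y : Submodule.span ℝ (Set.range u)),
      ∑ i, c i • (⟨u i, Submodule.subset_span (Set.mem_range_self i)⟩ :
          Submodule.span ℝ (Set.range u)) = y ↔ ∑ i, c i • u i = y := fun c y => by
    rw [Subtype.ext_iff]
    simp
  have hmem : ∀ x : {x : Fin d → ℤ | (fun j => (x j : ℝ)) ∈ S},
      ((fun j => (x.1 j : ℝ), (t : ℝ)) : (Fin d → ℝ) × ℝ) ∈ Submodule.span ℝ (Set.range u) := by
    rintro ⟨x, hx⟩
    obtain ⟨c, -, hc⟩ := (hS _).1 hx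
    rw [← hc]
    exact Submodule.sum_mem _ fun i _ =>
      Submodule.smul_mem _ _ (Submodule.subset_span (Set.mem_range_self i))
  refine Nat.card_eq_of_bijective (fun x => ⟨⟨_, hmem x⟩, mem_integerPoints.2 ⟨x.1, t, rfl⟩,
    ?_, rfl⟩) ⟨?_, ?_⟩
  · obtain ⟨c, hR, hc⟩ := (hS _).1 x.2
    exact ⟨c, hR, (hcoe _ _).2 hc⟩
  · rintro ⟨x, hx⟩ ⟨x', hx'⟩ heq
    simp only [Subtype.mk.injEq, Prod.mk.injEq, and_true] at heq
    exact Subtype.ext (funext fun j => by exact_mod_cast congrFun heq j)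
  · rintro ⟨⟨y, hy⟩, hint, ⟨c, hR, hc⟩, hyt⟩
    obtain ⟨n, m, rfl⟩ := mem_integerPoints.1 hint
    have hmt : (m : ℝ) = t := hyt
    refine ⟨⟨n, (hS _).2 ⟨c, hR, ?_⟩⟩, ?_⟩
    · rw [← hmt]
      exact (hcoe _ _).1 hc
    · simp [hmt]

end LatticePoints

lemma exists_common_denominator {ι κ : Type*} [Fintype ι] [Fintype κ] (q : ι → κ → ℚ) :
    ∃ N : ℕ, 0 < N ∧ ∀ i j, ∃ n : ℤ, (N : ℚ) * q i j = n := by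
  refine ⟨∏ i, ∏ j, (q i j).den, Finset.prod_pos fun i _ => Finset.prod_pos fun j _ =>
    (q i j).den_pos, fun i j => ?_⟩
  obtain ⟨k, hk⟩ := (Finset.dvd_prod_of_mem (fun j => (q i j).den) (Finset.mem_univ j)).trans
    (Finset.dvd_prod_of_mem (fun i => ∏ j, (q i j).den) (Finset.mem_univ i))
  refine ⟨k * (q i j).num, ?_⟩
  rw [hk]
  push_cast
  rw [mul_right_comm, mul_comm _ (q i j), Rat.mul_den_eq_num, mul_comm]

open Polynomial in
lemma exists_quasipolynomial_convexHull_range {ι : Type*} [Fintype ι] [Nonempty ι] {d : ℕ}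
    (q : ι → Fin d → ℚ) {P : Set (Fin d → ℝ)}
    (hP : P = convexHull ℝ (Set.range fun i j => (q i j : ℝ))) :
    ∃ N : ℕ, 0 < N ∧ ∃ p : ZMod N → ℚ[X], ∀ t : ℤ, 1 ≤ t →
      (p t).eval (t : ℚ) =
        Nat.card {x : Fin d → ℤ | (fun j => (x j : ℝ)) ∈ (t : ℝ) • P} ∧
      (-1) ^ Module.finrank ℝ (vectorSpan ℝ P) * (p (-t : ℤ)).eval ((-t : ℤ) : ℚ) =
        Nat.card {x : Fin d → ℤ | (fun j => (x j : ℝ)) ∈ (t : ℝ) • intrinsicInterior ℝ P} := by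
  obtain ⟨N, hN, hden⟩ := exists_common_denominator q
  have hN' : (0 : ℝ) < N := by exact_mod_cast hN
  set f : ι → Fin d → ℝ := fun i j => (q i j : ℝ)
  let u := coneGenerator f N
  let E := Submodule.span ℝ (Set.range u)
  let v : ι → E := fun i => ⟨u i, Submodule.subset_span (Set.mem_range_self i)⟩
  have hv : ∀ c : ι → ℝ, ((∑ i, c i • v i : E) : (Fin d → ℝ) × ℝ) = ∑ i, c i • u i := fun c => by
    simp [v]
  have hspan : Submodule.span ℝ (Set.range v) = ⊤ := by
    refine Submodule.map_injective_of_injective E.injective_subtype ?_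
    rw [Submodule.map_span, ← Set.range_comp, Submodule.map_top, Submodule.range_subtype]
    rfl
  have hvΛ : ∀ i, u i ∈ integerPoints d := fun i => by
    choose n hn using hden i
    refine mem_integerPoints.2 ⟨n, N, Prod.ext (funext fun j => ?_) (by simp [u, coneGenerator])⟩
    have := congrArg (Rat.cast (K := ℝ)) (hn j)
    push_cast at this
    simpa [u, coneGenerator, f] using this
  have hfin : {x : E | x ∈ (integerPoints d).comap E.subtype.toAddMonoidHom ∧
      ∃ c : ι → ℝ, (∀ i, c i ∈ Set.Icc 0 1) ∧ ∑ i, c i • v i = x}.Finite := by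
    refine ((finite_integerPoints_sum_Icc u).preimage
      (E.injective_subtype.injOn)).subset ?_
    rintro _ ⟨hx, c, hc, rfl⟩
    exact ⟨hx, c, hc, (hv c).symm⟩
  obtain ⟨p, hp⟩ := exists_quasipolynomial_cone (h := (LinearMap.snd ℝ _ _).comp E.subtype)
    hspan hN hvΛ (fun i => rfl) (fun x hx => by
      obtain ⟨n, m, h⟩ := mem_integerPoints.1 hx
      exact ⟨m, congrArg Prod.snd h⟩) hfin
  have hdim : Module.finrank ℝ E - 1 = Module.finrank ℝ (vectorSpan ℝ P) := by
    rw [finrank_span_coneGenerator f hN'.ne', Nat.add_sub_cancel, hP, ← direction_affineSpan,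
      ← direction_affineSpan, affineSpan_convexHull]
  refine ⟨N, hN, p, fun t ht => ?_⟩
  have ht' : (0 : ℝ) < t := by exact_mod_cast (by lia : 0 < t)
  rw [natCard_integer_eq_natCard_cone u (fun c => 0 ≤ c)
      (mem_smul_iff_exists_sum_coneGenerator hN' ht'
        (fun r hr c hc => smul_nonneg hr.le hc) (hP ▸ mem_convexHull_range_iff f)),
    natCard_integer_eq_natCard_cone u (fun c => ∀ i, 0 < c i)
      (mem_smul_iff_exists_sum_coneGenerator hN' ht'
        (fun r hr c hc i => mul_pos hr (hc i))
        (hP ▸ mem_intrinsicInterior_convexHull_range_iff f)), ← hdim]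
  exact hp t ht

/-- **Ehrhart–Macdonald reciprocity.** Let `P ⊂ ℝ^d` be a rational convex polytope (the
convex hull of finitely many points of `ℚ^d`), and for integers `t ≥ 1` let
`L_P(t) = #(tP ∩ ℤ^d)` and `L_{P°}(t) = #(tP° ∩ ℤ^d)`, where `P°` is the relative
interior of `P`.  Then `L_P` is a quasi-polynomial: there are `N ≥ 1` and polynomials
`p_c ∈ ℚ[t]` indexed by residues `c` mod `N` such that `f(t) = p_{t mod N}(t)` agrees
with `L_P(t)` for all `t ≥ 1`; moreover `(-1)^{dim P} f(-t) = L_{P°}(t)` for all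
integers `t ≥ 1`. -/
theorem ehrhart_macdonald_reciprocity
    (d : ℕ) (V : Finset (Fin d → ℚ)) (P : Set (Fin d → ℝ))
    (hP : P = convexHull ℝ ((fun v : Fin d → ℚ => fun j => ((v j : ℚ) : ℝ)) '' V)) :
    ∃ N : ℕ, 0 < N ∧ ∃ p : ZMod N → Polynomial ℚ,
      (∀ t : ℤ, 1 ≤ t →
        (p ((t : ℤ) : ZMod N)).eval (t : ℚ)
          = (Nat.card {x : Fin d → ℤ | (fun j => ((x j : ℤ) : ℝ)) ∈ (t : ℝ) • P} : ℚ)) ∧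
      (∀ t : ℤ, 1 ≤ t →
        (-1 : ℚ) ^ (Module.finrank ℝ (vectorSpan ℝ P)) *
            (p ((-t : ℤ) : ZMod N)).eval ((-t : ℤ) : ℚ)
          = (Nat.card {x : Fin d → ℤ |
              (fun j => ((x j : ℤ) : ℝ)) ∈ (t : ℝ) • intrinsicInterior ℝ P} : ℚ)) := by
  obtain rfl | hV := V.eq_empty_or_nonempty
  · have hP' : P = ∅ := by simpa using hP
    exact ⟨1, one_pos, fun _ => 0, by simp [hP'], by simp [hP']⟩
  · have : Nonempty V := hV.to_subtype
    rw [Set.image_eq_range] at hP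
    obtain ⟨N, hN, p, hp⟩ := exists_quasipolynomial_convexHull_range (fun v : V => v.1) hP
    exact ⟨N, hN, p, fun t ht => (hp t ht).1, fun t ht => (hp t ht).2⟩
end
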